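/- Let r be an integer with 2 ≤ r ≤ 5 and s = r+4. There is no curve class c = (d, m) with d ≥ 2, multiplicities in decreasing order m_1 ≥ ⋯ ≥ m_{r+4} ≥ 0, Cremona reduced (d ≥ m_1 + ⋯ + m_{r+1}), and satisfying the numerical (−1)-class condition (r+1)d − (r−1)Σ_{i=1}^{r+4} m_i = 3 − r. -/

import Mathlib

/-- Let 2 ≤ r ≤ 5 and s = r+4.  There is no curve class `c = (d, m)` with `d ≥ 2`,
multiplicities in decreasing order `m_1 ≥ ⋯ ≥ m_{r+4} ≥ 0`, Cremona reduced
(`d ≥ m_1 + ⋯ + m_{r+1}`) and satisfying the numerical (−1)-class condition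
`(r+1)d − (r−1)Σᵢ mᵢ = 3 − r`. -/
theorem no_cremona_reduced_numerical_minus_one_class_rplus4 (r : ℕ)
    (hr2 : 2 ≤ r) (hr5 : r ≤ 5) :
    ¬ ∃ (d : ℤ) (m : Fin (r + 4) → ℤ),
        2 ≤ d ∧ (∀ a b : Fin (r + 4), a ≤ b → m b ≤ m a) ∧ (∀ i, 0 ≤ m i) ∧
        (∑ i ∈ Finset.univ.filter (fun i : Fin (r + 4) => (i : ℕ) < r + 1), m i ≤ d) ∧
        ((r : ℤ) + 1) * d - ((r : ℤ) - 1) * ∑ i, m i = 3 - (r : ℤ) := by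
  rintro ⟨d, m, hd, hm, h0, hs, he⟩
  have key : ∀ i : Fin (r + 3), m i.succ ≤ m i.castSucc := fun i =>
    hm _ _ (le_of_lt (Fin.castSucc_lt_succ))
  clear hm
  rw [Finset.sum_filter] at hs
  interval_cases r <;>
  · simp [Fin.sum_univ_succ, Fin.forall_fin_succ] at hs he key h0
    linarith
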